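/- Let k ≥ 2 and T'_k = (σ₁σ₃)^{2k−2}(σ₃σ₄Δ₃)(Δ₃σ₄)[(δ₃σ₄)(δ̃₃σ₄)]^{k−1}(δ₃σ₄σ₃σ₄) ∈ B₅. Then the conjugate x = σ₂⁻¹ T'_k σ₂ satisfies: Δ⁻¹ ≼ x, x is not positive, x ≼ Δ^{4k−1}, and ¬(x ≼ Δ^{4k−2}). In particular inf x = −1, sup x = 4k−1, its canonical length is 4k, and σ₂⁻¹T'_kσ₂ does not belong to the super summit set of T'_k. -/

import Mathlib

/-- Defining relations of the braid group on 5 strands, as elements of the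
free group on four generators (generator `i` corresponds to `σ_{i+1}`). -/
def braidRels : Set (FreeGroup (Fin 4)) :=
  { r | (∃ i : Fin 3, r = FreeGroup.of i.castSucc * FreeGroup.of i.succ * FreeGroup.of i.castSucc *
          (FreeGroup.of i.succ * FreeGroup.of i.castSucc * FreeGroup.of i.succ)⁻¹) ∨
        (∃ i j : Fin 4, 2 ≤ |(i : ℤ) - (j : ℤ)| ∧
          r = FreeGroup.of i * FreeGroup.of j * (FreeGroup.of j * FreeGroup.of i)⁻¹) }

/-- The Artin braid group on 5 strands. -/
abbrev B5 : Type := PresentedGroup braidRels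

/-- The Artin generators (index `i` corresponds to `σ_{i+1}`). -/
def gen (i : Fin 4) : B5 := PresentedGroup.of i

def s1 : B5 := gen 0
def s2 : B5 := gen 1
def s3 : B5 := gen 2
def s4 : B5 := gen 3

/-- A braid is positive if it lies in the submonoid generated by `σ₁,…,σ₄`. -/
def IsPos (x : B5) : Prop := x ∈ Submonoid.closure (Set.range gen)

/-- Prefix order: `Pre x y` means `x ≼ y`, i.e. `x⁻¹ y` is positive. -/
def Pre (x y : B5) : Prop := IsPos (x⁻¹ * y)

/-- The half twist `Δ = σ₁σ₂σ₃σ₄σ₁σ₂σ₃σ₁σ₂σ₁`. -/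
def Δ : B5 := s1*s2*s3*s4*s1*s2*s3*s1*s2*s1

def δ3 : B5 := s2*s1
def Δ3 : B5 := s2*s1*s2
def δt3 : B5 := s1*s2

/-- A braid `s` is simple if `1 ≼ s ≼ Δ`. -/
def IsSimple (s : B5) : Prop := IsPos s ∧ Pre s Δ

/-- Two simple braids `s, t` are left-weighted if no generator `σᵢ` is such that
`s σᵢ` and `σᵢ⁻¹ t` are both simple. -/
def LeftWeighted (s t : B5) : Prop :=
  ¬ ∃ i : Fin 4, IsSimple (s * gen i) ∧ IsSimple ((gen i)⁻¹ * t)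

/-- The canonical length of `z`: the minimum of `q - p` over `p ≤ q` with
`Δ^p ≼ z` and `z ≼ Δ^q`. -/
noncomputable def canLen (z : B5) : ℕ :=
  sInf { n : ℕ | ∃ p q : ℤ, p ≤ q ∧ q - p = (n : ℤ) ∧ Pre (Δ ^ p) z ∧ Pre z (Δ ^ q) }

/-- `y` belongs to the super summit set of `x`:
`y` is conjugate to `x` and has minimal canonical length among conjugates of `x`. -/
def InSSS (x y : B5) : Prop :=
  IsConj x y ∧ ∀ z : B5, IsConj x z → canLen y ≤ canLen z

/-- The braid `T_k = δ₃^{3k+1} σ₄^{2k+2} σ₃ σ₄^{2k-1}`. -/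
def T (k : ℕ) : B5 := δ3 ^ (3*k+1) * s4 ^ (2*k+2) * s3 * s4 ^ (2*k-1)

/-- The braid `T'_k`, a rigid conjugate of `T_k`. -/
def T' (k : ℕ) : B5 :=
  (s1*s3)^(2*k-2) * (s3*s4*Δ3) * (Δ3*s4) * ((δ3*s4)*(δt3*s4))^(k-1) * (δ3*s4*s3*s4)

/-- The constant coefficients of the rescaled Lawrence–Krammer–Bigelow matrices of the generators of
`B5`, for the parameters `q = 1/2` and `t = 16 X`. The basis vectors are indexed by the pairs
`12, 13, 14, 15, 23, 24, 25, 34, 35, 45`. -/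
def lkbConst : Fin 4 → Matrix (Fin 10) (Fin 10) ℤ
  | 0 =>
    !![0, 0, 0, 0, 0, 0, 0, 0, 0, 0;
       0, 0, 0, 0, 2, 0, 0, 0, 0, 0;
       0, 0, 0, 0, 0, 2, 0, 0, 0, 0;
       0, 0, 0, 0, 0, 0, 2, 0, 0, 0;
       0, 1, 0, 0, 1, 0, 0, 0, 0, 0;
       0, 0, 1, 0, 0, 1, 0, 0, 0, 0;
       0, 0, 0, 1, 0, 0, 1, 0, 0, 0;
       0, 0, 0, 0, 0, 0, 0, 2, 0, 0;
       0, 0, 0, 0, 0, 0, 0, 0, 2, 0;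
       0, 0, 0, 0, 0, 0, 0, 0, 0, 2]
  | 1 =>
    !![1, 2, 0, 0, 0, 0, 0, 0, 0, 0;
       1, 0, 0, 0, 0, 0, 0, 0, 0, 0;
       0, 0, 2, 0, 0, 0, 0, 0, 0, 0;
       0, 0, 0, 2, 0, 0, 0, 0, 0, 0;
       0, 0, 0, 0, 0, 0, 0, 0, 0, 0;
       0, 0, 0, 0, 0, 0, 0, 2, 0, 0;
       0, 0, 0, 0, 0, 0, 0, 0, 2, 0;
       0, 0, 0, 0, 0, 1, 0, 1, 0, 0;
       0, 0, 0, 0, 0, 0, 1, 0, 1, 0;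
       0, 0, 0, 0, 0, 0, 0, 0, 0, 2]
  | 2 =>
    !![2, 0, 0, 0, 0, 0, 0, 0, 0, 0;
       0, 1, 2, 0, 0, 0, 0, 0, 0, 0;
       0, 1, 0, 0, 0, 0, 0, 0, 0, 0;
       0, 0, 0, 2, 0, 0, 0, 0, 0, 0;
       0, 0, 0, 0, 1, 2, 0, 0, 0, 0;
       0, 0, 0, 0, 1, 0, 0, 0, 0, 0;
       0, 0, 0, 0, 0, 0, 2, 0, 0, 0;
       0, 0, 0, 0, 0, 0, 0, 0, 0, 0;
       0, 0, 0, 0, 0, 0, 0, 0, 0, 2;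
       0, 0, 0, 0, 0, 0, 0, 0, 1, 1]
  | 3 =>
    !![2, 0, 0, 0, 0, 0, 0, 0, 0, 0;
       0, 2, 0, 0, 0, 0, 0, 0, 0, 0;
       0, 0, 1, 2, 0, 0, 0, 0, 0, 0;
       0, 0, 1, 0, 0, 0, 0, 0, 0, 0;
       0, 0, 0, 0, 2, 0, 0, 0, 0, 0;
       0, 0, 0, 0, 0, 1, 2, 0, 0, 0;
       0, 0, 0, 0, 0, 1, 0, 0, 0, 0;
       0, 0, 0, 0, 0, 0, 0, 1, 2, 0;
       0, 0, 0, 0, 0, 0, 0, 1, 0, 0;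
       0, 0, 0, 0, 0, 0, 0, 0, 0, 0]

/-- The coefficients of `X` in the rescaled Lawrence–Krammer–Bigelow matrices. -/
def lkbLin : Fin 4 → Matrix (Fin 10) (Fin 10) ℤ
  | 0 =>
    !![8, -8, -8, -8, 0, 0, 0, 0, 0, 0;
       0, 0, 0, 0, 0, 0, 0, 0, 0, 0;
       0, 0, 0, 0, 0, 0, 0, 0, 0, 0;
       0, 0, 0, 0, 0, 0, 0, 0, 0, 0;
       0, 0, 0, 0, 0, 0, 0, 0, 0, 0;
       0, 0, 0, 0, 0, 0, 0, 0, 0, 0;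
       0, 0, 0, 0, 0, 0, 0, 0, 0, 0;
       0, 0, 0, 0, 0, 0, 0, 0, 0, 0;
       0, 0, 0, 0, 0, 0, 0, 0, 0, 0;
       0, 0, 0, 0, 0, 0, 0, 0, 0, 0]
  | 1 =>
    !![0, 0, 0, 0, 0, 0, 0, 0, 0, 0;
       0, 0, 0, 0, 0, 0, 0, 0, 0, 0;
       0, 0, 0, 0, 0, 0, 0, 0, 0, 0;
       0, 0, 0, 0, 0, 0, 0, 0, 0, 0;
       0, -4, 4, 4, 8, -8, -8, 0, 0, 0;
       0, 0, 0, 0, 0, 0, 0, 0, 0, 0;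
       0, 0, 0, 0, 0, 0, 0, 0, 0, 0;
       0, 0, 0, 0, 0, 0, 0, 0, 0, 0;
       0, 0, 0, 0, 0, 0, 0, 0, 0, 0;
       0, 0, 0, 0, 0, 0, 0, 0, 0, 0]
  | 2 =>
    !![0, 0, 0, 0, 0, 0, 0, 0, 0, 0;
       0, 0, 0, 0, 0, 0, 0, 0, 0, 0;
       0, 0, 0, 0, 0, 0, 0, 0, 0, 0;
       0, 0, 0, 0, 0, 0, 0, 0, 0, 0;
       0, 0, 0, 0, 0, 0, 0, 0, 0, 0;
       0, 0, 0, 0, 0, 0, 0, 0, 0, 0;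
       0, 0, 0, 0, 0, 0, 0, 0, 0, 0;
       0, 0, -2, 2, 0, -4, 4, 8, -8, 0;
       0, 0, 0, 0, 0, 0, 0, 0, 0, 0;
       0, 0, 0, 0, 0, 0, 0, 0, 0, 0]
  | 3 =>
    !![0, 0, 0, 0, 0, 0, 0, 0, 0, 0;
       0, 0, 0, 0, 0, 0, 0, 0, 0, 0;
       0, 0, 0, 0, 0, 0, 0, 0, 0, 0;
       0, 0, 0, 0, 0, 0, 0, 0, 0, 0;
       0, 0, 0, 0, 0, 0, 0, 0, 0, 0;
       0, 0, 0, 0, 0, 0, 0, 0, 0, 0;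
       0, 0, 0, 0, 0, 0, 0, 0, 0, 0;
       0, 0, 0, 0, 0, 0, 0, 0, 0, 0;
       0, 0, 0, 0, 0, 0, 0, 0, 0, 0;
       0, 0, 0, -1, 0, 0, -2, 0, -4, 8]

open Polynomial

/-- The rescaled Lawrence–Krammer–Bigelow matrices, as polynomials with matrix coefficients. -/
noncomputable def lkbPoly (i : Fin 4) : (Matrix (Fin 10) (Fin 10) ℤ)[X] :=
  C (lkbConst i) + C (lkbLin i) * X

theorem linear_mul_mul {A : Type*} [Ring A] (a b c d e f : A) :
    (C a + C b * X) * (C c + C d * X) * (C e + C f * X) =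
      C (a * c * e) + C (a * c * f + a * d * e + b * c * e) * X +
        C (a * d * f + b * c * f + b * d * e) * X ^ 2 + C (b * d * f) * X ^ 3 := by
  simp only [C_mul_X_eq_monomial, C_mul_X_pow_eq_monomial]
  simp only [← monomial_zero_left, add_mul, mul_add, monomial_mul_monomial, map_add, zero_add,
    add_zero, Nat.reduceAdd]
  abel

theorem linear_mul {A : Type*} [Ring A] (a b c d : A) :
    (C a + C b * X) * (C c + C d * X) =
      C (a * c) + C (a * d + b * c) * X + C (b * d) * X ^ 2 := by
  simp only [C_mul_X_eq_monomial, C_mul_X_pow_eq_monomial]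
  simp only [← monomial_zero_left, add_mul, mul_add, monomial_mul_monomial, map_add, zero_add,
    add_zero, Nat.reduceAdd]
  abel

theorem lkbPoly_braid (i : Fin 3) :
    lkbPoly i.castSucc * lkbPoly i.succ * lkbPoly i.castSucc =
      lkbPoly i.succ * lkbPoly i.castSucc * lkbPoly i.succ := by
  simp only [lkbPoly, linear_mul_mul]
  refine congrArg₂ (· + ·) (congrArg₂ (· + ·) (congrArg₂ (· + ·) (congrArg C ?_)
    (congrArg (C · * X) ?_)) (congrArg (C · * X ^ 2) ?_)) (congrArg (C · * X ^ 3) ?_) <;>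
  · revert i
    decide +kernel

theorem lkbPoly_comm (i j : Fin 4) (h : 2 ≤ |(i : ℤ) - (j : ℤ)|) :
    lkbPoly i * lkbPoly j = lkbPoly j * lkbPoly i := by
  simp only [lkbPoly, linear_mul]
  refine congrArg₂ (· + ·) (congrArg₂ (· + ·) (congrArg C ?_)
    (congrArg (C · * X) ?_)) (congrArg (C · * X ^ 2) ?_) <;>
  · revert i j
    decide +kernel

/-- By the cubic relation `(B - 2) (B + 1) (B - 8 X) = 0`, this is `-16 X` times the inverse of
`lkbPoly i`. -/
noncomputable def lkbCofactor (i : Fin 4) : (Matrix (Fin 10) (Fin 10) ℤ)[X] :=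
  C (lkbConst i * lkbConst i - lkbConst i - 2) +
    C (lkbConst i * lkbLin i + lkbLin i * lkbConst i - lkbLin i - 8 * lkbConst i + 8) * X

theorem lkbPoly_mul_cofactor (i : Fin 4) : lkbPoly i * lkbCofactor i = C (-16) * X := by
  rw [lkbPoly, lkbCofactor, linear_mul]
  have h0 : lkbConst i * (lkbConst i * lkbConst i - lkbConst i - 2) = 0 := by
    revert i; decide +kernel
  have h1 : lkbConst i *
        (lkbConst i * lkbLin i + lkbLin i * lkbConst i - lkbLin i - 8 * lkbConst i + 8) +
      lkbLin i * (lkbConst i * lkbConst i - lkbConst i - 2) = -16 := by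
    revert i; decide +kernel
  have h2 : lkbLin i *
      (lkbConst i * lkbLin i + lkbLin i * lkbConst i - lkbLin i - 8 * lkbConst i + 8) = 0 := by
    revert i; decide +kernel
  rw [h0, h1, h2, C_0, zero_add, zero_mul, add_zero]

theorem lkbCofactor_mul_poly (i : Fin 4) : lkbCofactor i * lkbPoly i = C (-16) * X := by
  rw [lkbPoly, lkbCofactor, linear_mul]
  have h0 : (lkbConst i * lkbConst i - lkbConst i - 2) * lkbConst i = 0 := by
    revert i; decide +kernel
  have h1 : (lkbConst i * lkbConst i - lkbConst i - 2) * lkbLin i +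
      (lkbConst i * lkbLin i + lkbLin i * lkbConst i - lkbLin i - 8 * lkbConst i + 8) *
        lkbConst i = -16 := by
    revert i; decide +kernel
  have h2 : (lkbConst i * lkbLin i + lkbLin i * lkbConst i - lkbLin i - 8 * lkbConst i + 8) *
      lkbLin i = 0 := by
    revert i; decide +kernel
  rw [h0, h1, h2, C_0, zero_add, zero_mul, add_zero]

/-- Extension of scalars from integral polynomials to rational Laurent polynomials. -/
noncomputable def toLaurentRat :
    (Matrix (Fin 10) (Fin 10) ℤ)[X] →+* LaurentPolynomial (Matrix (Fin 10) (Fin 10) ℚ) :=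
  Polynomial.toLaurent.comp (mapRingHom (Int.castRingHom ℚ).mapMatrix)

theorem toLaurentRat_injective : Function.Injective toLaurentRat :=
  toLaurent_injective.comp <|
    map_injective _ <| Matrix.map_injective (Int.castRingHom ℚ).injective_int

theorem isUnit_toLaurentRat_lkbPoly (i : Fin 4) : IsUnit (toLaurentRat (lkbPoly i)) := by
  have hc : Commute (toLaurentRat (lkbPoly i)) (toLaurentRat (lkbCofactor i)) := by
    rw [Commute, SemiconjBy, ← map_mul, ← map_mul, lkbPoly_mul_cofactor, lkbCofactor_mul_poly]
  refine (hc.isUnit_mul_iff.1 ?_).1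
  rw [← map_mul, lkbPoly_mul_cofactor]
  have h16 : IsUnit (Int.castRingHom ℚ |>.mapMatrix (-16 : Matrix (Fin 10) (Fin 10) ℤ)) := by
    have h : IsUnit (algebraMap ℚ (Matrix (Fin 10) (Fin 10) ℚ) (-16)) :=
      (isUnit_iff_ne_zero.2 (by norm_num)).map _
    rw [map_neg, map_ofNat] at h ⊢
    exact h
  simp only [toLaurentRat, RingHom.comp_apply, map_mul, coe_mapRingHom, map_X, map_C,
    toLaurent_X, toLaurent_C]
  exact (h16.map LaurentPolynomial.C).mul (LaurentPolynomial.isUnit_T 1)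

/-- The Lawrence–Krammer–Bigelow representation of `B5`. -/
noncomputable def lkb : B5 →* (LaurentPolynomial (Matrix (Fin 10) (Fin 10) ℚ))ˣ :=
  PresentedGroup.toGroup (f := fun i => (isUnit_toLaurentRat_lkbPoly i).unit) <| by
    rintro r (⟨i, rfl⟩ | ⟨i, j, h, rfl⟩)
    · rw [map_mul, map_inv, mul_inv_eq_one]
      ext1
      simp only [map_mul, FreeGroup.lift_apply_of, Units.val_mul, IsUnit.unit_spec]
      simp only [← map_mul, lkbPoly_braid]
    · rw [map_mul, map_inv, mul_inv_eq_one]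
      ext1
      simp only [map_mul, FreeGroup.lift_apply_of, Units.val_mul, IsUnit.unit_spec]
      simp only [← map_mul, lkbPoly_comm i j h]

theorem lkb_gen (i : Fin 4) : (lkb (gen i) : LaurentPolynomial _) = toLaurentRat (lkbPoly i) := by
  simp [lkb, gen]

/-- `g` acts by an integral matrix of polynomials with constant coefficient `N`. -/
def HasConst (g : B5) (N : Matrix (Fin 10) (Fin 10) ℤ) : Prop :=
  ∃ P, (lkb g : LaurentPolynomial _) = toLaurentRat P ∧ P.coeff 0 = N

theorem HasConst.unique {g : B5} {N N' : Matrix (Fin 10) (Fin 10) ℤ} :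
    HasConst g N → HasConst g N' → N = N' := by
  rintro ⟨P, hP, rfl⟩ ⟨P', hP', rfl⟩
  rw [toLaurentRat_injective (hP.symm.trans hP')]

theorem HasConst.mul {g h : B5} {N N' : Matrix (Fin 10) (Fin 10) ℤ} :
    HasConst g N → HasConst h N' → HasConst (g * h) (N * N') := by
  rintro ⟨P, hP, rfl⟩ ⟨P', hP', rfl⟩
  exact ⟨P * P', by simp [hP, hP'], mul_coeff_zero _ _⟩

theorem hasConst_one : HasConst 1 1 := ⟨1, by simp, by simp⟩

theorem hasConst_gen (i : Fin 4) : HasConst (gen i) (lkbConst i) :=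
  ⟨_, lkb_gen i, by simp [lkbPoly]⟩

theorem IsPos.exists_hasConst {g : B5} (hg : IsPos g) : ∃ N, HasConst g N := by
  induction hg using Submonoid.closure_induction with
  | mem x hx =>
    obtain ⟨i, rfl⟩ := hx
    exact ⟨_, hasConst_gen i⟩
  | one => exact ⟨_, hasConst_one⟩
  | mul x y _ _ hx hy =>
    obtain ⟨N, hN⟩ := hx
    obtain ⟨N', hN'⟩ := hy
    exact ⟨_, hN.mul hN'⟩

/-- `g` is a positive braid whose constant coefficient matrix is nonnegative, with positive
entry at `(r, c)`. -/
def PosEntry (r c : Fin 10) (g : B5) : Prop :=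
  IsPos g ∧ ∃ N, HasConst g N ∧ (∀ i j, 0 ≤ N i j) ∧ 0 < N r c

theorem posEntry_one (r : Fin 10) : PosEntry r r 1 := by
  refine ⟨one_mem _, 1, hasConst_one, fun i j => ?_, by simp⟩
  rw [Matrix.one_apply]
  split_ifs <;> simp

theorem PosEntry.mul {r c d : Fin 10} {g h : B5} (hg : PosEntry r c g) (hh : PosEntry c d h) :
    PosEntry r d (g * h) := by
  obtain ⟨pg, N, hN, nN, eN⟩ := hg
  obtain ⟨ph, N', hN', nN', eN'⟩ := hh
  refine ⟨mul_mem pg ph, _, hN.mul hN', fun i j => ?_, ?_⟩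
  · rw [Matrix.mul_apply]
    exact Finset.sum_nonneg fun k _ => mul_nonneg (nN i k) (nN' k j)
  · rw [Matrix.mul_apply]
    exact Finset.sum_pos' (fun k _ => mul_nonneg (nN r k) (nN' k d))
      ⟨c, Finset.mem_univ _, mul_pos eN eN'⟩

theorem PosEntry.pow {r : Fin 10} {g : B5} (hg : PosEntry r r g) (n : ℕ) :
    PosEntry r r (g ^ n) := by
  induction n with
  | zero => simpa using posEntry_one r
  | succ n ih => exact pow_succ g n ▸ ih.mul hg

theorem lkbConst_nonneg (i : Fin 4) (r c : Fin 10) : 0 ≤ lkbConst i r c := by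
  have h : ∀ i, ∀ p : Fin 10 × Fin 10, 0 ≤ lkbConst i p.1 p.2 := by decide +kernel
  exact h i (r, c)

theorem posEntry_gen {i : Fin 4} {r c : Fin 10} (h : 0 < lkbConst i r c) :
    PosEntry r c (gen i) :=
  ⟨Submonoid.subset_closure ⟨i, rfl⟩, _, hasConst_gen i, lkbConst_nonneg i, h⟩

/-- The braid represented by a positive word. -/
def braidWord (l : List (Fin 4)) : B5 := (l.map gen).prod

/-- The columns in which row `r` of the constant coefficient matrix of a word is positive. -/
def support : List (Fin 4) → List (Fin 10) → List (Fin 10)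
  | [], S => S
  | i :: l, S => support l
      ((List.finRange 10).filter fun c => S.any fun r => decide (0 < lkbConst i r c))

theorem exists_posEntry_of_mem_support {l : List (Fin 4)} {S : List (Fin 10)} {c : Fin 10}
    (h : c ∈ support l S) : ∃ r ∈ S, PosEntry r c (braidWord l) := by
  induction l generalizing S with
  | nil => exact ⟨c, h, posEntry_one c⟩
  | cons i l ih =>
    obtain ⟨d, hd, hdc⟩ := ih h
    simp only [List.mem_filter, List.any_eq_true, decide_eq_true_eq] at hd
    obtain ⟨-, r, hr, hrd⟩ := hd
    exact ⟨r, hr, by simpa [braidWord] using (posEntry_gen hrd).mul hdc⟩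

theorem posEntry_braidWord {l : List (Fin 4)} {r c : Fin 10} (h : c ∈ support l [r]) :
    PosEntry r c (braidWord l) := by
  obtain ⟨r', hr', h⟩ := exists_posEntry_of_mem_support h
  exact List.mem_singleton.1 hr' ▸ h

/-- A braid with a positive entry in row `23` is not divisible by `σ₂` on the left. -/
theorem PosEntry.not_isPos_inv_s2_mul {c : Fin 10} {g : B5} (hg : PosEntry 4 c g) :
    ¬ IsPos (s2⁻¹ * g) := by
  intro h
  obtain ⟨-, N, hN, -, hpos⟩ := hg
  obtain ⟨N', hN'⟩ := h.exists_hasConst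
  have h2 := (hasConst_gen 1).mul hN'
  rw [← s2, mul_inv_cancel_left] at h2
  have hrow : ∀ k, lkbConst 1 4 k = 0 := by decide +kernel
  rw [hN.unique h2, Matrix.mul_apply] at hpos
  simp [hrow] at hpos

theorem hasConst_braidWord (l : List (Fin 4)) :
    HasConst (braidWord l) (l.map lkbConst).prod := by
  induction l with
  | nil => exact hasConst_one
  | cons i l ih => simpa [braidWord] using (hasConst_gen i).mul ih

theorem prod_lkbConst_eq_zero {l : List (Fin 4)} {S : List (Fin 10)} {r c : Fin 10}
    (hr : r ∈ S) (h : c ∉ support l S) : (l.map lkbConst).prod r c = 0 := by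
  induction l generalizing S r with
  | nil =>
    have hrc : r ≠ c := fun e => h (e ▸ hr)
    simp [hrc]
  | cons i l ih =>
    rw [List.map_cons, List.prod_cons, Matrix.mul_apply]
    refine Finset.sum_eq_zero fun d _ => ?_
    rcases (lkbConst_nonneg i r d).eq_or_lt with h0 | h0
    · rw [← h0, zero_mul]
    · rw [ih (S := _) ?_ h, mul_zero]
      simpa using ⟨r, hr, h0⟩

theorem hasConst_Δ : HasConst Δ 0 := by
  have h := hasConst_braidWord [0, 1, 2, 3, 0, 1, 2, 0, 1, 0]
  have h0 : ∀ r, support [0, 1, 2, 3, 0, 1, 2, 0, 1, 0] [r] = [] := by decide +kernel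
  convert h using 1
  · simp [Δ, braidWord, s1, s2, s3, s4, mul_assoc]
  · ext r c
    exact (prod_lkbConst_eq_zero (List.mem_singleton_self r) (by simp [h0])).symm

/-- A braid with a positive entry is not divisible by `Δ` on the right. -/
theorem PosEntry.not_isPos_mul_inv_Δ {r c : Fin 10} {g : B5} (hg : PosEntry r c g) :
    ¬ IsPos (g * Δ⁻¹) := by
  intro h
  obtain ⟨-, N, hN, -, hpos⟩ := hg
  obtain ⟨N', hN'⟩ := h.exists_hasConst
  have h2 := hN'.mul hasConst_Δ
  rw [inv_mul_cancel_right] at h2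
  simp [hN.unique h2] at hpos

theorem gen_braid (i : Fin 3) :
    gen i.castSucc * gen i.succ * gen i.castSucc = gen i.succ * gen i.castSucc * gen i.succ :=
  mul_inv_eq_one.1 (PresentedGroup.one_of_mem (rels := braidRels) (Or.inl ⟨i, rfl⟩))

theorem gen_comm (i j : Fin 4) (h : 2 ≤ |(i : ℤ) - (j : ℤ)|) : gen i * gen j = gen j * gen i :=
  mul_inv_eq_one.1 (PresentedGroup.one_of_mem (rels := braidRels) (Or.inr ⟨i, j, h, rfl⟩))

theorem s3_s1_mul (z : B5) : s3 * (s1 * z) = s1 * (s3 * z) := by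
  rw [← mul_assoc, ← mul_assoc]
  exact congrArg (· * z) (gen_comm 2 0 (by decide))

theorem s4_s1_mul (z : B5) : s4 * (s1 * z) = s1 * (s4 * z) := by
  rw [← mul_assoc, ← mul_assoc]
  exact congrArg (· * z) (gen_comm 3 0 (by decide))

theorem s4_s2_mul (z : B5) : s4 * (s2 * z) = s2 * (s4 * z) := by
  rw [← mul_assoc, ← mul_assoc]
  exact congrArg (· * z) (gen_comm 3 1 (by decide))

theorem s2_s1_s2_mul (z : B5) : s2 * (s1 * (s2 * z)) = s1 * (s2 * (s1 * z)) := by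
  simp only [← mul_assoc]
  exact congrArg (· * z) (gen_braid 0).symm

theorem s3_s2_s3_mul (z : B5) : s3 * (s2 * (s3 * z)) = s2 * (s3 * (s2 * z)) := by
  simp only [← mul_assoc]
  exact congrArg (· * z) (gen_braid 1).symm

theorem s4_s3_s4_mul (z : B5) : s4 * (s3 * (s4 * z)) = s3 * (s4 * (s3 * z)) := by
  simp only [← mul_assoc]
  exact congrArg (· * z) (gen_braid 2).symm

theorem s3_s2_s1_s3_mul (z : B5) : s3 * (s2 * (s1 * (s3 * z))) = s2 * (s3 * (s2 * (s1 * z))) := by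
  rw [← s3_s1_mul, s3_s2_s3_mul]

theorem s4_s3_s2_s4_mul (z : B5) : s4 * (s3 * (s2 * (s4 * z))) = s3 * (s4 * (s3 * (s2 * z))) := by
  rw [← s4_s2_mul, s4_s3_s4_mul]

theorem s4_s3_s2_s1_s4_mul (z : B5) :
    s4 * (s3 * (s2 * (s1 * (s4 * z)))) = s3 * (s4 * (s3 * (s2 * (s1 * z)))) := by
  rw [← s4_s1_mul, s4_s3_s2_s4_mul]

/-- Words for `Δ` starting and ending with given generators. -/
theorem gen_words_eq_Δ :
    s1*s2*s3*s4*s1*s2*s3*s2*s1 * s2 = Δ ∧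
    s1 * (s2*s1*s3*s2*s1*s4*s3*s2*s1) = Δ ∧ s2*s1*s3*s2*s1*s4*s3*s2*s1 * s4 = Δ ∧
    s2 * (s1*s2*s3*s2*s1*s4*s3*s2*s1) = Δ ∧ s1*s2*s3*s2*s1*s4*s3*s2*s1 * s3 = Δ ∧
    s3 * (s1*s2*s1*s3*s4*s3*s2*s1*s3) = Δ ∧ s1*s2*s1*s3*s4*s3*s2*s1*s3 * s2 = Δ ∧
    s4 * (s1*s2*s1*s3*s2*s1*s4*s3*s2) = Δ ∧ s1*s2*s1*s3*s2*s1*s4*s3*s2 * s1 = Δ := by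
  refine ⟨?_, ?_, ?_, ?_, ?_, ?_, ?_, ?_, ?_⟩ <;>
  · refine mul_right_cancel (b := (1 : B5)) ?_
    simp only [Δ, mul_assoc, s3_s1_mul, s4_s1_mul, s4_s2_mul, s2_s1_s2_mul,
      s3_s2_s1_s3_mul, s4_s3_s2_s1_s4_mul]

/-- Complements of the simple factors of `T' k`. -/
theorem factor_mul_complement :
    s1*s3 * (s2*s1*s3*s2*s4*s3*s2*s1) = Δ ∧
    s3*s4*Δ3 * (s3*s2*s1*s4*s3) = Δ ∧
    Δ3*s4 * (s3*s2*s1*s4*s3*s2) = Δ ∧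
    δ3*s4 * (s2*s3*s2*s1*s4*s3*s2) = Δ ∧
    δt3*s4 * (s1*s3*s2*s1*s4*s3*s2) = Δ ∧
    δ3*s4*s3*s4 * (s2*s1*s3*s2*s4) = Δ := by
  refine ⟨?_, ?_, ?_, ?_, ?_, ?_⟩ <;>
  · refine mul_right_cancel (b := (1 : B5)) ?_
    simp only [Δ, Δ3, δ3, δt3, mul_assoc, s3_s1_mul, s4_s1_mul, s4_s2_mul, s2_s1_s2_mul,
      s3_s2_s1_s3_mul, s4_s3_s2_s1_s4_mul]

theorem Δ_mul_eq {a b w : B5} (ha : a * w = Δ) (hb : w * b = Δ) : Δ * b = a * Δ := by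
  rw [← ha, mul_assoc, hb, ha]

theorem Δ_mul_s1 : Δ * s1 = s4 * Δ :=
  Δ_mul_eq gen_words_eq_Δ.2.2.2.2.2.2.2.1 gen_words_eq_Δ.2.2.2.2.2.2.2.2

theorem Δ_mul_s2 : Δ * s2 = s3 * Δ := Δ_mul_eq gen_words_eq_Δ.2.2.2.2.2.1 gen_words_eq_Δ.2.2.2.2.2.2.1

theorem Δ_mul_s3 : Δ * s3 = s2 * Δ := Δ_mul_eq gen_words_eq_Δ.2.2.2.1 gen_words_eq_Δ.2.2.2.2.1

theorem Δ_mul_s4 : Δ * s4 = s1 * Δ := Δ_mul_eq gen_words_eq_Δ.2.1 gen_words_eq_Δ.2.2.1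

theorem Δ_sq_commute_gen (i : Fin 4) : Commute (Δ ^ 2) (gen i) := by
  have key : ∀ {a b : B5}, Δ * a = b * Δ → Δ * b = a * Δ → Commute (Δ ^ 2) a := by
    intro a b h h'
    rw [Commute, SemiconjBy, pow_two, mul_assoc, h, ← mul_assoc, h', mul_assoc]
  fin_cases i
  · exact key Δ_mul_s1 Δ_mul_s4
  · exact key Δ_mul_s2 Δ_mul_s3
  · exact key Δ_mul_s3 Δ_mul_s2
  · exact key Δ_mul_s4 Δ_mul_s1

theorem Δ_sq_commute (g : B5) : Commute (Δ ^ 2) g := by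
  have h : g ∈ Subgroup.centralizer {Δ ^ 2} := by
    have hle : Subgroup.closure (Set.range gen) ≤ Subgroup.centralizer {Δ ^ 2} := by
      rw [Subgroup.closure_le]
      rintro _ ⟨i, rfl⟩
      exact Subgroup.mem_centralizer_singleton_iff.2 (Δ_sq_commute_gen i).symm
    exact hle (PresentedGroup.closure_range_of braidRels ▸ Subgroup.mem_top g)
  exact (Subgroup.mem_centralizer_singleton_iff.1 h).symm

theorem Δ_pow_even_commute (n : ℕ) (g : B5) : Commute (Δ ^ (2 * n)) g := by
  rw [pow_mul]
  exact (Δ_sq_commute g).pow_left n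

/-- A product of two simple braids and its complement in `Δ ^ 2`, the latter twisted by `Δ`. -/
theorem mul_Δ_mul_eq_Δ_pow_three {a a' b b' c : B5} (h : a * b = Δ) (h' : a' * b' = Δ)
    (hc : Δ * c = b' * Δ) : a * a' * Δ * (c * b) = Δ ^ 3 := by
  calc a * a' * Δ * (c * b) = a * (a' * (Δ * c)) * b := by simp only [mul_assoc]
    _ = a * Δ ^ 2 * b := by rw [hc, ← mul_assoc a', h', pow_two]
    _ = Δ ^ 3 := by rw [mul_assoc, (Δ_sq_commute b).eq, ← mul_assoc, h, pow_succ' Δ 2]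

theorem mul_Δ_pow_mul {a b : B5} (h : a * Δ * b = Δ ^ 3) (n : ℕ) :
    a * Δ ^ (2 * n + 1) * b = Δ ^ (2 * (n + 1) + 1) := by
  rw [pow_succ, ← mul_assoc, ← (Δ_pow_even_commute n a).eq, mul_assoc, mul_assoc, ← mul_assoc a, h,
    ← pow_add]
  rfl

theorem pow_mul_Δ_pow_mul_pow {a b : B5} (h : a * Δ * b = Δ ^ 3) (n m : ℕ) :
    a ^ m * Δ ^ (2 * n + 1) * b ^ m = Δ ^ (2 * (n + m) + 1) := by
  induction m generalizing n with
  | zero => simp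
  | succ m ih =>
    calc a ^ (m + 1) * Δ ^ (2 * n + 1) * b ^ (m + 1)
        = a ^ m * (a * Δ ^ (2 * n + 1) * b) * b ^ m := by
          rw [pow_succ a, pow_succ' b]; simp only [mul_assoc]
      _ = Δ ^ (2 * (n + (m + 1)) + 1) := by
          rw [mul_Δ_pow_mul h, ih]
          congr 2
          ring

/-- The complement of `T' (m + 1)` in `Δ ^ (4 * m + 3)`, with its first letter `σ₂` removed. -/
def complementTail (m : ℕ) : B5 :=
  braidWord [0, 2, 1, 3] * braidWord [3, 1, 2, 3, 0, 1, 2, 1, 2, 1, 0, 3, 2, 1] ^ m *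
    braidWord [1, 2, 3, 0, 1, 2, 2, 1, 0, 3, 2] *
    braidWord [2, 3, 1, 2, 0, 1, 2, 3, 1, 0, 2, 1, 3, 2, 1, 0] ^ m

theorem T'_mul_complement (m : ℕ) :
    T' (m + 1) * (s2 * complementTail m) = Δ ^ (4 * m + 3) := by
  obtain ⟨h1, h2, h3, h4, h5, h6⟩ := factor_mul_complement
  have hA : s1*s3 * (s1*s3) * Δ * braidWord [2, 3, 1, 2, 0, 1, 2, 3, 1, 0, 2, 1, 3, 2, 1, 0] =
      Δ ^ 3 := by
    refine Eq.trans ?_ (mul_Δ_mul_eq_Δ_pow_three (c := s3*s4*s2*s3*s1*s2*s3*s4) h1 h1 ?_)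
    · simp [braidWord, s1, s2, s3, s4, mul_assoc]
    · simp only [← mul_assoc, Δ_mul_s3]
      simp only [mul_assoc, Δ_mul_s1, Δ_mul_s2, Δ_mul_s3, Δ_mul_s4]
  have hM : s3*s4*Δ3 * (Δ3*s4) * Δ * braidWord [1, 2, 3, 0, 1, 2, 2, 1, 0, 3, 2] = Δ ^ 3 := by
    refine Eq.trans ?_ (mul_Δ_mul_eq_Δ_pow_three (c := s2*s3*s4*s1*s2*s3) h2 h3 ?_)
    · simp [braidWord, s1, s2, s3, s4, mul_assoc]
    · simp only [← mul_assoc, Δ_mul_s2]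
      simp only [mul_assoc, Δ_mul_s1, Δ_mul_s2, Δ_mul_s3, Δ_mul_s4]
  have hC : δ3*s4 * (δt3*s4) * Δ * braidWord [3, 1, 2, 3, 0, 1, 2, 1, 2, 1, 0, 3, 2, 1] =
      Δ ^ 3 := by
    refine Eq.trans ?_ (mul_Δ_mul_eq_Δ_pow_three (c := s4*s2*s3*s4*s1*s2*s3) h4 h5 ?_)
    · simp [braidWord, s1, s2, s3, s4, mul_assoc]
    · simp only [← mul_assoc, Δ_mul_s4]
      simp only [mul_assoc, Δ_mul_s1, Δ_mul_s2, Δ_mul_s3, Δ_mul_s4]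
  have hD : δ3*s4*s3*s4 * (s2 * braidWord [0, 2, 1, 3]) = Δ := by
    refine Eq.trans ?_ h6
    simp [braidWord, s1, s2, s3, s4, mul_assoc]
  have hCm := pow_mul_Δ_pow_mul_pow hC 0 m
  have hMm := mul_Δ_pow_mul hM (0 + m)
  have hAm := pow_mul_Δ_pow_mul_pow hA (0 + m + 1) m
  rw [mul_zero, zero_add, pow_one] at hCm
  rw [show 4 * m + 3 = 2 * (0 + m + 1 + m) + 1 by ring, ← hAm, ← hMm, ← hCm,
    show (δ3*s4*(δt3*s4))^m * Δ = _ * (_ * _) from congrArg _ hD.symm, T', complementTail,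
    show 2 * (m + 1) - 2 = 2 * m by omega, Nat.add_sub_cancel, pow_mul, pow_two]
  simp only [mul_assoc]

theorem posEntry_complementTail_mul_s3 (m : ℕ) : PosEntry 4 4 (complementTail m * s3) := by
  have hE : PosEntry 4 0 (braidWord [0, 2, 1, 3]) := posEntry_braidWord (by decide +kernel)
  have hV : PosEntry 0 0 (braidWord [3, 1, 2, 3, 0, 1, 2, 1, 2, 1, 0, 3, 2, 1]) :=
    posEntry_braidWord (by decide +kernel)
  have hW : PosEntry 0 4 (braidWord [1, 2, 3, 0, 1, 2, 2, 1, 0, 3, 2]) :=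
    posEntry_braidWord (by decide +kernel)
  have hU : PosEntry 4 4 (braidWord [2, 3, 1, 2, 0, 1, 2, 3, 1, 0, 2, 1, 3, 2, 1, 0]) :=
    posEntry_braidWord (by decide +kernel)
  exact (((hE.mul (hV.pow m)).mul hW).mul (hU.pow m)).mul (posEntry_gen (by decide +kernel))

theorem posEntry_T'_mul_s2 (m : ℕ) : PosEntry 4 0 (T' (m + 1) * s2) := by
  have hA : PosEntry 4 4 (braidWord [0, 2, 0, 2]) := posEntry_braidWord (by decide +kernel)
  have hM : PosEntry 4 7 (braidWord [2, 3, 1, 0, 1, 1, 0, 1, 3]) :=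
    posEntry_braidWord (by decide +kernel)
  have hC : PosEntry 7 7 (braidWord [1, 0, 3, 0, 1, 3]) := posEntry_braidWord (by decide +kernel)
  have hD : PosEntry 7 0 (braidWord [1, 0, 3, 2, 3, 1]) := posEntry_braidWord (by decide +kernel)
  convert (((hA.pow m).mul hM).mul (hC.pow m)).mul hD using 1
  rw [T', show 2 * (m + 1) - 2 = 2 * m by omega, Nat.add_sub_cancel, pow_mul, pow_two]
  simp [braidWord, s1, s2, s3, s4, δ3, δt3, Δ3, mul_assoc]

theorem isPos_gen (i : Fin 4) : IsPos (gen i) := Submonoid.subset_closure ⟨i, rfl⟩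

theorem IsPos.mul {g h : B5} (hg : IsPos g) (hh : IsPos h) : IsPos (g * h) := mul_mem hg hh

theorem IsPos.pow {g : B5} (hg : IsPos g) (n : ℕ) : IsPos (g ^ n) := Submonoid.pow_mem _ hg n

theorem isPos_braidWord (l : List (Fin 4)) : IsPos (braidWord l) := by
  refine Submonoid.list_prod_mem _ fun x hx => ?_
  obtain ⟨i, -, rfl⟩ := List.mem_map.1 hx
  exact isPos_gen i

theorem isPos_Δ : IsPos Δ := by
  convert isPos_braidWord [0, 1, 2, 3, 0, 1, 2, 0, 1, 0] using 1
  simp [Δ, braidWord, s1, s2, s3, s4, mul_assoc]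

theorem isPos_Δ_zpow {p : ℤ} (hp : 0 ≤ p) : IsPos (Δ ^ p) := by
  lift p to ℕ using hp
  exact zpow_natCast Δ p ▸ isPos_Δ.pow p

theorem Pre.trans {x y z : B5} (h : Pre x y) (h' : Pre y z) : Pre x z := by
  have := IsPos.mul h h'
  rwa [mul_assoc, mul_inv_cancel_left] at this

theorem pre_Δ_zpow {p q : ℤ} (h : p ≤ q) : Pre (Δ ^ p) (Δ ^ q) := by
  rw [Pre, ← zpow_neg, ← zpow_add]
  exact isPos_Δ_zpow (by omega)

theorem canLen_le {z : B5} {p q : ℤ} (n : ℕ) (hpq : q - p = n) (hp : Pre (Δ ^ p) z)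
    (hq : Pre z (Δ ^ q)) : canLen z ≤ n :=
  Nat.sInf_le ⟨p, q, by omega, hpq, hp, hq⟩

theorem canLen_eq {z : B5} {p q : ℤ} (n : ℕ) (hpq : q - p = n)
    (hp : IsGreatest {p : ℤ | Pre (Δ ^ p) z} p) (hq : IsLeast {q : ℤ | Pre z (Δ ^ q)} q) :
    canLen z = n := by
  refine le_antisymm (canLen_le n hpq hp.1 hq.1) ?_
  refine le_csInf ⟨n, p, q, by omega, hpq, hp.1, hq.1⟩ ?_
  rintro n' ⟨p', q', -, h, hp', hq'⟩
  have := hp.2 hp'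
  have := hq.2 hq'
  omega

theorem Δ_pow_odd_mul_s3 (n : ℕ) : Δ ^ (2 * n + 1) * s3 = s2 * Δ ^ (2 * n + 1) := by
  rw [pow_succ, mul_assoc, Δ_mul_s3, ← mul_assoc, (Δ_pow_even_commute n s2).eq, mul_assoc]

/-- The complement of `s2⁻¹ * T' (m + 1) * s2` in `Δ ^ (4 * m + 3)`. -/
theorem inv_conj_mul_Δ_pow (m : ℕ) :
    (s2⁻¹ * T' (m + 1) * s2)⁻¹ * Δ ^ (4 * m + 3) = complementTail m * s3 := by
  rw [inv_mul_eq_iff_eq_mul]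
  have h := Δ_pow_odd_mul_s3 (2 * m + 1)
  rw [show 2 * (2 * m + 1) + 1 = 4 * m + 3 by ring] at h
  calc Δ ^ (4 * m + 3) = s2⁻¹ * (Δ ^ (4 * m + 3) * s3) := by rw [h, inv_mul_cancel_left]
    _ = s2⁻¹ * T' (m + 1) * s2 * (complementTail m * s3) := by
      rw [← T'_mul_complement]; simp only [mul_assoc]

theorem isPos_T' (k : ℕ) : IsPos (T' k) := by
  convert (((((isPos_braidWord [0, 2]).pow (2 * k - 2)).mul
    (isPos_braidWord [2, 3, 1, 0, 1, 1, 0, 1, 3])).mul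
    ((isPos_braidWord [1, 0, 3, 0, 1, 3]).pow (k - 1))).mul
    (isPos_braidWord [1, 0, 3, 2, 3])) using 1
  simp [T', braidWord, s1, s2, s3, s4, δ3, δt3, Δ3, mul_assoc]

theorem isPos_complementTail (m : ℕ) : IsPos (complementTail m) :=
  (((isPos_braidWord _).mul ((isPos_braidWord _).pow m)).mul (isPos_braidWord _)).mul
    ((isPos_braidWord _).pow m)

theorem pre_T' (m : ℕ) : Pre (T' (m + 1)) (Δ ^ (4 * m + 3)) := by
  rw [Pre, ← T'_mul_complement, inv_mul_cancel_left]
  exact (isPos_gen 1).mul (isPos_complementTail m)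

theorem pre_inv_Δ_conj (k : ℕ) : Pre Δ⁻¹ (s2⁻¹ * T' k * s2) := by
  rw [Pre, inv_inv, ← gen_words_eq_Δ.1]
  convert ((isPos_braidWord [0, 1, 2, 3, 0, 1, 2, 1, 0]).mul (isPos_T' k)).mul (isPos_gen 1) using 1
  simp [braidWord, s1, s2, s3, s4, mul_assoc]

/-- the conjugate `x = σ₂⁻¹ T'_k σ₂` satisfies `Δ⁻¹ ≼ x`, `x` is not
positive, `x ≼ Δ^{4k-1}` and `¬(x ≼ Δ^{4k-2})`; in particular `inf x = -1`,
`sup x = 4k-1`, its canonical length is `4k`, and `x` is not in the super summit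
set of `T'_k`. -/
theorem conj_s2_not_SSS (k : ℕ) (hk : 2 ≤ k) :
    Pre Δ⁻¹ (s2⁻¹ * T' k * s2) ∧ ¬ IsPos (s2⁻¹ * T' k * s2) ∧
    Pre (s2⁻¹ * T' k * s2) (Δ ^ (4*k-1)) ∧ ¬ Pre (s2⁻¹ * T' k * s2) (Δ ^ (4*k-2)) ∧
    IsGreatest { p : ℤ | Pre (Δ ^ p) (s2⁻¹ * T' k * s2) } (-1) ∧
    IsLeast { q : ℤ | Pre (s2⁻¹ * T' k * s2) (Δ ^ q) } (4*(k:ℤ) - 1) ∧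
    canLen (s2⁻¹ * T' k * s2) = 4*k ∧
    ¬ InSSS (T' k) (s2⁻¹ * T' k * s2) := by
  obtain ⟨m, rfl⟩ : ∃ m, k = m + 1 := ⟨k - 1, by omega⟩
  rw [show 4 * (m + 1) - 1 = 4 * m + 3 by omega, show 4 * (m + 1) - 2 = 4 * m + 2 by omega]
  set x := s2⁻¹ * T' (m + 1) * s2 with hx
  have hpre : Pre Δ⁻¹ x := pre_inv_Δ_conj (m + 1)
  have hnpos : ¬ IsPos x := by
    rw [hx, mul_assoc]
    exact (posEntry_T'_mul_s2 m).not_isPos_inv_s2_mul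
  have hpre' : Pre x (Δ ^ (4 * m + 3)) := by
    rw [Pre, hx, inv_conj_mul_Δ_pow]
    exact (posEntry_complementTail_mul_s3 m).1
  have hnpre : ¬ Pre x (Δ ^ (4 * m + 2)) := by
    have h := (posEntry_complementTail_mul_s3 m).not_isPos_mul_inv_Δ
    rwa [← inv_conj_mul_Δ_pow, pow_succ, ← mul_assoc, mul_inv_cancel_right] at h
  have hgr : IsGreatest {p : ℤ | Pre (Δ ^ p) x} (-1) := by
    refine ⟨by simpa using hpre, fun p hp => ?_⟩
    by_contra! hlt
    have h := (pre_Δ_zpow (show 0 ≤ p by omega)).trans hp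
    exact hnpos (by simpa [Pre] using h)
  have hle : IsLeast {q : ℤ | Pre x (Δ ^ q)} (4 * ((m + 1 : ℕ) : ℤ) - 1) := by
    rw [show 4 * ((m + 1 : ℕ) : ℤ) - 1 = ((4 * m + 3 : ℕ) : ℤ) by push_cast; ring]
    refine ⟨by rwa [Set.mem_ofPred_eq, zpow_natCast], fun q hq => ?_⟩
    by_contra! hlt
    have h := Pre.trans hq (pre_Δ_zpow (q := (4 * m + 2 : ℕ)) (by push_cast at hlt ⊢; omega))
    rw [zpow_natCast] at h
    exact hnpre h
  have hlen : canLen x = 4 * (m + 1) := canLen_eq _ (by push_cast; ring) hgr hle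
  refine ⟨hpre, hnpos, hpre', hnpre, hgr, hle, hlen, fun h => ?_⟩
  have hT : canLen (T' (m + 1)) ≤ 4 * m + 3 := by
    refine canLen_le (p := 0) (q := (4 * m + 3 : ℕ)) _ (by simp) ?_ ?_
    · simpa [Pre] using isPos_T' (m + 1)
    · simpa only [zpow_natCast] using pre_T' m
  have := h.2 _ (IsConj.refl _)
  omega
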